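/- Fix m : ℕ with m ≥ 1, a finite type n, j : Fin m, an n×n complex matrix M, and ψ : n → ℂ. Then ⟨R⁽ᵐ⁾(ψ), R⁽ᵐ⁾_j(M) *ᵥ R⁽ᵐ⁾(ψ)⟩ = Re⟨ψ, M *ᵥ ψ⟩ (the real part of the original expectation value, coerced to ℂ). -/

import Mathlib

open Matrix Kronecker Complex

/-- The 2×2 change-of-basis matrix V = (1/√2)·[[1,1],[i,-i]]. -/
noncomputable def Vmat : Matrix (Fin 2) (Fin 2) ℂ :=
  ((Real.sqrt 2 : ℂ))⁻¹ • !![1, 1; Complex.I, -Complex.I]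

/-- The m-fold tensor power V^{⊗m}, indexed by bit strings Fin m → Fin 2. -/
noncomputable def Vtens (m : ℕ) : Matrix (Fin m → Fin 2) (Fin m → Fin 2) ℂ :=
  fun z w => ∏ j, Vmat (z j) (w j)

/-- The coherent mixture χ = (1/√2)(|0…0⟩|ψ⟩ + |1…1⟩|ψ*⟩). -/
noncomputable def chiVec {n : Type*} (m : ℕ) (ψ : n → ℂ) : (Fin m → Fin 2) × n → ℂ :=
  fun p =>
    if p.1 = fun _ => (0 : Fin 2) then ((Real.sqrt 2 : ℂ))⁻¹ * ψ p.2
    else if p.1 = fun _ => (1 : Fin 2) then ((Real.sqrt 2 : ℂ))⁻¹ * star (ψ p.2)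
    else 0

/-- The multi-party real simulation R⁽ᵐ⁾(ψ) of a state, with m "extra" qubits. -/
noncomputable def Rm {n : Type*} [Fintype n] [DecidableEq n] (m : ℕ) (ψ : n → ℂ) :
    (Fin m → Fin 2) × n → ℂ :=
  (Vtens m ⊗ₖ (1 : Matrix n n ℂ)) *ᵥ chiVec m ψ

/-- D_j(M): apply M when the j-th extra qubit reads 0 and conj M when it reads 1. -/
def Dj {n : Type*} (m : ℕ) (j : Fin m) (M : Matrix n n ℂ) :
    Matrix ((Fin m → Fin 2) × n) ((Fin m → Fin 2) × n) ℂ :=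
  fun p q =>
    if p.1 = q.1 then (if p.1 j = 0 then M p.2 q.2 else star (M p.2 q.2)) else 0

/-- The multi-party real simulation R⁽ᵐ⁾_j(M) of an operator applied by the j-th party. -/
noncomputable def Rmj {n : Type*} [Fintype n] [DecidableEq n] (m : ℕ) (j : Fin m)
    (M : Matrix n n ℂ) :
    Matrix ((Fin m → Fin 2) × n) ((Fin m → Fin 2) × n) ℂ :=
  (Vtens m ⊗ₖ (1 : Matrix n n ℂ)) * Dj m j M * (Vtens m ⊗ₖ (1 : Matrix n n ℂ))ᴴ

theorem inv_sqrt_two_mul_self : ((Real.sqrt 2 : ℂ))⁻¹ * ((Real.sqrt 2 : ℂ))⁻¹ = 1 / 2 := by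
  rw [← mul_inv, ← Complex.ofReal_mul, Real.mul_self_sqrt (by norm_num)]
  norm_num

theorem Vmat_conjTranspose_mul_self : Vmatᴴ * Vmat = 1 := by
  ext a b
  fin_cases a <;> fin_cases b <;>
    simp [Vmat, Matrix.mul_apply, Fin.sum_univ_two] <;>
    grind [Complex.I_mul_I, inv_sqrt_two_mul_self]

theorem Vtens_conjTranspose_mul_self (m : ℕ) : (Vtens m)ᴴ * Vtens m = 1 := by
  ext w w'
  have h : ((Vtens m)ᴴ * Vtens m) w w' = ∏ j, (Vmatᴴ * Vmat) (w j) (w' j) := by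
    simp only [Matrix.mul_apply, Vtens, Matrix.conjTranspose_apply, star_prod,
      ← Finset.prod_mul_distrib, Finset.prod_univ_sum, Fintype.piFinset_univ]
  rw [h, Vmat_conjTranspose_mul_self]
  simp [Matrix.one_apply, Finset.prod_ite_zero, funext_iff]

theorem Vtens_kronecker_one_conjTranspose_mul_self (m : ℕ) (n : Type*) [Fintype n]
    [DecidableEq n] :
    (Vtens m ⊗ₖ (1 : Matrix n n ℂ))ᴴ * (Vtens m ⊗ₖ (1 : Matrix n n ℂ)) = 1 := by
  rw [Matrix.conjTranspose_kronecker, ← Matrix.mul_kronecker_mul,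
    Vtens_conjTranspose_mul_self, Matrix.conjTranspose_one, Matrix.one_mul,
    Matrix.one_kronecker_one]

theorem Dj_mulVec_chiVec {n : Type*} [Fintype n] (m : ℕ) (j : Fin m) (M : Matrix n n ℂ)
    (ψ : n → ℂ) : Dj m j M *ᵥ chiVec m ψ = chiVec m (M *ᵥ ψ) := by
  ext ⟨z, a⟩
  have h : (Dj m j M *ᵥ chiVec m ψ) (z, a) =
      ∑ b, (if z j = 0 then M a b else star (M a b)) * chiVec m ψ (z, b) := by
    simp [Matrix.mulVec, dotProduct, Dj, Fintype.sum_prod_type, ite_mul]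
  rw [h]
  by_cases h0 : z = fun _ => 0
  · subst h0
    simp [chiVec, Matrix.mulVec, dotProduct, Finset.mul_sum, mul_left_comm]
  by_cases h1 : z = fun _ => 1
  · subst h1
    simp [chiVec, h0, Matrix.mulVec, dotProduct, Finset.mul_sum, mul_left_comm]
  · simp [chiVec, h0, h1]

theorem star_chiVec_dotProduct_chiVec {n : Type*} [Fintype n] {m : ℕ} (hm : 1 ≤ m)
    (ψ φ : n → ℂ) :
    star (chiVec m ψ) ⬝ᵥ chiVec m φ = ((star ψ ⬝ᵥ φ).re : ℂ) := by
  have hne : (fun _ : Fin m => (1 : Fin 2)) ≠ fun _ => 0 := fun e => by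
    simpa using congrFun e ⟨0, hm⟩
  have key : ∀ a, ∑ z, star (chiVec m ψ (z, a)) * chiVec m φ (z, a) =
      (((star (ψ a) * φ a).re : ℝ) : ℂ) := by
    intro a
    rw [Fintype.sum_eq_add _ _ hne.symm (fun z hz => by simp [chiVec, hz.1, hz.2]),
      Complex.re_eq_add_conj]
    simp only [chiVec, if_true, hne, if_false, star_mul', star_inv₀, Complex.star_def,
      Complex.conj_ofReal, map_mul, Complex.conj_conj]
    linear_combination ((starRingEnd ℂ) (ψ a) * φ a + ψ a * (starRingEnd ℂ) (φ a)) *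
      inv_sqrt_two_mul_self
  simp only [dotProduct, Pi.star_apply]
  rw [Fintype.sum_prod_type_right, Finset.sum_congr rfl fun a _ => key a, Complex.re_sum,
    Complex.ofReal_sum]

/-- ⟨R⁽ᵐ⁾(ψ), R⁽ᵐ⁾_j(M) *ᵥ R⁽ᵐ⁾(ψ)⟩ = Re ⟨ψ, M *ᵥ ψ⟩ (coerced to ℂ). -/
theorem multiparty_real_sim_expectation
    {m : ℕ} (hm : 1 ≤ m) {n : Type*} [Fintype n] [DecidableEq n]
    (j : Fin m) (M : Matrix n n ℂ) (ψ : n → ℂ) :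
    ∑ p, star (Rm m ψ p) * (Rmj m j M *ᵥ Rm m ψ) p
      = (((∑ a, star (ψ a) * (M *ᵥ ψ) a).re : ℝ) : ℂ) := by
  set W := Vtens m ⊗ₖ (1 : Matrix n n ℂ) with hW
  have hWW : Wᴴ * W = 1 := Vtens_kronecker_one_conjTranspose_mul_self m n
  change star (Rm m ψ) ⬝ᵥ (Rmj m j M *ᵥ Rm m ψ) = ((star ψ ⬝ᵥ (M *ᵥ ψ)).re : ℂ)
  have hR : Rmj m j M *ᵥ Rm m ψ = W *ᵥ chiVec m (M *ᵥ ψ) := by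
    rw [Rmj, Rm, ← hW, Matrix.mulVec_mulVec, Matrix.mul_assoc, hWW, Matrix.mul_one,
      ← Matrix.mulVec_mulVec, Dj_mulVec_chiVec]
  rw [hR, Rm, ← hW, Matrix.star_mulVec, Matrix.dotProduct_mulVec, Matrix.vecMul_vecMul, hWW,
    Matrix.vecMul_one, star_chiVec_dotProduct_chiVec hm]
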